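/- arXiv:2211.12196 — 3 statements merged into one kernel-verified Lean document; each statement's English description precedes it below -/
import Mathlib

section
/- Let {S^i}_{i∈V} be an admissible multi-set satisfying the one-step invariance condition, i.e., S^i ⊆ Z for every i ∈ V and Φ(σ, S^s) ⊆ S^d for every edge (s, d, σ) ∈ E. Then S^i ⊆ B_l^i for every l ≥ 0 and every i ∈ V. -/
/-- One-step forward reachability map `Φ`. -/
def Phi {n m p : ℕ} (A : Matrix (Fin n) (Fin n) ℝ) (B : Matrix (Fin n) (Fin m) ℝ)
    (Ed : Matrix (Fin n) (Fin p) ℝ) (𝒜 : (Fin n → ℝ) → Set (Fin m → ℝ))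
    (H : Set (Fin p → ℝ)) (S : Set (Fin n → ℝ)) : Set (Fin n → ℝ) :=
  {y | ∃ z ∈ S, ∃ a ∈ 𝒜 z, ∃ h ∈ H, y = A.mulVec z + B.mulVec a + Ed.mulVec h}

/-- One-step backward reachability map `Ψ`. -/
def Psi {n m p : ℕ} (A : Matrix (Fin n) (Fin n) ℝ) (B : Matrix (Fin n) (Fin m) ℝ)
    (Ed : Matrix (Fin n) (Fin p) ℝ) (𝒜 : (Fin n → ℝ) → Set (Fin m → ℝ))
    (H : Set (Fin p → ℝ)) (S : Set (Fin n → ℝ)) : Set (Fin n → ℝ) :=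
  {z | ∀ a ∈ 𝒜 z, ∀ h ∈ H, A.mulVec z + B.mulVec a + Ed.mulVec h ∈ S}

/-- Backward reachability multi-set sequence. -/
def Bseq {n m p : ℕ} {V Λ : Type*}
    (A : Matrix (Fin n) (Fin n) ℝ) (B : Λ → Matrix (Fin n) (Fin m) ℝ)
    (Ed : Matrix (Fin n) (Fin p) ℝ) (𝒜 : Λ → (Fin n → ℝ) → Set (Fin m → ℝ))
    (H : Set (Fin p → ℝ)) (E : Set (V × V × Λ)) (Z : Set (Fin n → ℝ)) :
    ℕ → V → Set (Fin n → ℝ)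
  | 0, _ => Z
  | l + 1, i => Z ∩ ⋂ d, ⋂ σ, ⋂ _ : (i, d, σ) ∈ E,
      Psi A (B σ) Ed (𝒜 σ) H (Bseq A B Ed 𝒜 H E Z l d)

/-- every admissible multi-set satisfying the one-step invariance
condition is contained in every term of the backward reachability sequence. -/
theorem admissible_invariant_subset_Bseq
    {n m p : ℕ} {V Λ : Type*} [Fintype V] [Fintype Λ]
    (A : Matrix (Fin n) (Fin n) ℝ) (B : Λ → Matrix (Fin n) (Fin m) ℝ)
    (Ed : Matrix (Fin n) (Fin p) ℝ) (𝒜 : Λ → (Fin n → ℝ) → Set (Fin m → ℝ))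
    (H : Set (Fin p → ℝ)) (E : Set (V × V × Λ)) (Z : Set (Fin n → ℝ))
    (S : V → Set (Fin n → ℝ))
    (hadm : ∀ i, S i ⊆ Z)
    (hinv : ∀ s d σ', (s, d, σ') ∈ E → Phi A (B σ') Ed (𝒜 σ') H (S s) ⊆ S d) :
    ∀ (l : ℕ) (i : V), S i ⊆ Bseq A B Ed 𝒜 H E Z l i := by
  intro l
  induction l with
  | zero => exact hadm
  | succ l ih =>
    intro i z hz
    refine ⟨hadm i hz, ?_⟩
    simp only [Set.mem_iInter]
    intro d σ hE a ha h hh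
    exact ih d (hinv i d σ hE ⟨z, hz, a, ha, h, hh, rfl⟩)
end

section
/- Suppose there exists k ≥ 0 such that B_{k+1}^i = B_k^i for every i ∈ V. Then the multi-set {B_k^i}_{i∈V} is the maximal admissible invariant multi-set: (i) B_k^i ⊆ Z for every i ∈ V; (ii) Φ(σ, B_k^i) ⊆ B_k^d for every edge (i, d, σ) ∈ E; and (iii) every admissible multi-set {S^i}_{i∈V} satisfying the one-step invariance condition satisfies S^i ⊆ B_k^i for every i ∈ V. -/
/-- The Galois connection between forward and backward reachability. -/
theorem Phi_subset_iff_subset_Psi {n m p : ℕ} (A : Matrix (Fin n) (Fin n) ℝ)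
    (B : Matrix (Fin n) (Fin m) ℝ) (Ed : Matrix (Fin n) (Fin p) ℝ)
    (𝒜 : (Fin n → ℝ) → Set (Fin m → ℝ)) (H : Set (Fin p → ℝ)) (S T : Set (Fin n → ℝ)) :
    Phi A B Ed 𝒜 H S ⊆ T ↔ S ⊆ Psi A B Ed 𝒜 H T := by
  constructor
  · intro hST z hz a ha h hh
    exact hST ⟨z, hz, a, ha, h, hh, rfl⟩
  · rintro hST _ ⟨z, hz, a, ha, h, hh, rfl⟩
    exact hST hz a ha h hh

theorem Psi_mono {n m p : ℕ} (A : Matrix (Fin n) (Fin n) ℝ)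
    (B : Matrix (Fin n) (Fin m) ℝ) (Ed : Matrix (Fin n) (Fin p) ℝ)
    (𝒜 : (Fin n → ℝ) → Set (Fin m → ℝ)) (H : Set (Fin p → ℝ)) {S T : Set (Fin n → ℝ)}
    (hST : S ⊆ T) : Psi A B Ed 𝒜 H S ⊆ Psi A B Ed 𝒜 H T :=
  fun _ hz a ha h hh => hST (hz a ha h hh)

theorem Bseq_subset {n m p : ℕ} {V Λ : Type*}
    (A : Matrix (Fin n) (Fin n) ℝ) (B : Λ → Matrix (Fin n) (Fin m) ℝ)
    (Ed : Matrix (Fin n) (Fin p) ℝ) (𝒜 : Λ → (Fin n → ℝ) → Set (Fin m → ℝ))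
    (H : Set (Fin p → ℝ)) (E : Set (V × V × Λ)) (Z : Set (Fin n → ℝ)) (l : ℕ) (i : V) :
    Bseq A B Ed 𝒜 H E Z l i ⊆ Z := by
  cases l with
  | zero => exact subset_rfl
  | succ l => exact Set.inter_subset_left

/-- Every admissible invariant multi-set is contained in every term of the backward sequence. -/
theorem subset_Bseq_of_invariant {n m p : ℕ} {V Λ : Type*}
    (A : Matrix (Fin n) (Fin n) ℝ) (B : Λ → Matrix (Fin n) (Fin m) ℝ)
    (Ed : Matrix (Fin n) (Fin p) ℝ) (𝒜 : Λ → (Fin n → ℝ) → Set (Fin m → ℝ))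
    (H : Set (Fin p → ℝ)) (E : Set (V × V × Λ)) (Z : Set (Fin n → ℝ))
    (S : V → Set (Fin n → ℝ)) (hSZ : ∀ i, S i ⊆ Z)
    (hS : ∀ s d σ', (s, d, σ') ∈ E → Phi A (B σ') Ed (𝒜 σ') H (S s) ⊆ S d) (l : ℕ) (i : V) :
    S i ⊆ Bseq A B Ed 𝒜 H E Z l i := by
  induction l generalizing i with
  | zero => exact hSZ i
  | succ l ih =>
    refine Set.subset_inter (hSZ i) ?_
    refine Set.subset_iInter fun d => Set.subset_iInter fun σ' => Set.subset_iInter fun he => ?_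
    exact ((Phi_subset_iff_subset_Psi ..).1 (hS i d σ' he)).trans (Psi_mono _ _ _ _ _ (ih d))

/-- a fixed point of the backward recursion is the maximal
admissible invariant multi-set. -/
theorem Bseq_fixed_point_maximal
    {n m p : ℕ} {V Λ : Type*} [Fintype V] [Fintype Λ]
    (A : Matrix (Fin n) (Fin n) ℝ) (B : Λ → Matrix (Fin n) (Fin m) ℝ)
    (Ed : Matrix (Fin n) (Fin p) ℝ) (𝒜 : Λ → (Fin n → ℝ) → Set (Fin m → ℝ))
    (H : Set (Fin p → ℝ)) (E : Set (V × V × Λ)) (Z : Set (Fin n → ℝ))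
    (k : ℕ)
    (hfix : ∀ i : V, Bseq A B Ed 𝒜 H E Z (k + 1) i = Bseq A B Ed 𝒜 H E Z k i) :
    (∀ i : V, Bseq A B Ed 𝒜 H E Z k i ⊆ Z) ∧
    (∀ i d σ', (i, d, σ') ∈ E →
      Phi A (B σ') Ed (𝒜 σ') H (Bseq A B Ed 𝒜 H E Z k i) ⊆ Bseq A B Ed 𝒜 H E Z k d) ∧
    (∀ S : V → Set (Fin n → ℝ), (∀ i, S i ⊆ Z) →
      (∀ s d σ', (s, d, σ') ∈ E → Phi A (B σ') Ed (𝒜 σ') H (S s) ⊆ S d) →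
      ∀ i, S i ⊆ Bseq A B Ed 𝒜 H E Z k i) := by
  refine ⟨Bseq_subset A B Ed 𝒜 H E Z k, fun i d σ' he => ?_,
    fun S hSZ hS => subset_Bseq_of_invariant A B Ed 𝒜 H E Z S hSZ hS k⟩
  rw [Phi_subset_iff_subset_Psi]
  intro z hz
  rw [← hfix i] at hz
  exact Set.mem_iInter.1 (Set.mem_iInter.1 (Set.mem_iInter.1 hz.2 d) σ') he
end

section
/- Let A ∈ ℝ^{n×n} be such that every complex eigenvalue of A has modulus strictly less than 1, and let W ⊆ ℝⁿ be nonempty and compact. Define F_0 = {0} and F_l = {Σ_{j=0}^{l−1} A^j w_j : w_0, …, w_{l−1} ∈ W} for l ≥ 1. Then: (i) there exists a nonempty compact set S_m ⊆ ℝⁿ with d_H(F_l, S_m) → 0 as l → ∞ (the sequence (F_l) converges in the Hausdorff distance); (ii) S_m is robustly invariant for the system x⁺ = A x + w: {A x + w : x ∈ S_m, w ∈ W} ⊆ S_m; and (iii) S_m is minimal: every nonempty closed set S ⊆ ℝⁿ with {A x + w : x ∈ S, w ∈ W} ⊆ S satisfies S_m ⊆ S. -/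
open Filter Topology

/-- In a complex Banach algebra, the powers of an element of spectral radius less than one are
absolutely summable. -/
theorem summable_norm_pow_of_spectralRadius_lt_one {B : Type*} [NormedRing B]
    [NormedAlgebra ℂ B] [CompleteSpace B] {a : B} (ha : spectralRadius ℂ a < 1) :
    Summable fun k : ℕ => ‖a ^ k‖ := by
  obtain ⟨r, hr, hr1⟩ := ENNReal.lt_iff_exists_nnreal_btwn.1 ha
  have hr1 : r < 1 := by exact_mod_cast hr1
  refine summable_of_isBigO_nat (NNReal.summable_coe.2 (NNReal.summable_geometric hr1)) ?_
  refine Asymptotics.IsBigO.of_bound 1 ?_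
  filter_upwards [(spectrum.pow_nnnorm_pow_one_div_tendsto_nhds_spectralRadius a).eventually_lt_const
    hr, eventually_gt_atTop 0] with k hk hk0
  have hk0' : (0 : ℝ) < k := by exact_mod_cast hk0
  rw [one_div, ENNReal.rpow_inv_lt_iff hk0', ENNReal.rpow_natCast] at hk
  have h : ‖a ^ k‖₊ < r ^ k := by exact_mod_cast hk
  simpa using (NNReal.coe_lt_coe.2 h).le

attribute [local instance] Matrix.linftyOpNormedAddCommGroup Matrix.linftyOpNormedRing
  Matrix.linftyOpNormedAlgebra

/-- The powers of a Schur-stable real matrix are absolutely summable. -/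
theorem Matrix.summable_linfty_opNorm_pow {n : ℕ} (A : Matrix (Fin n) (Fin n) ℝ)
    (hA : ∀ μ ∈ spectrum ℂ (A.map (Complex.ofReal)), ‖μ‖ < 1) :
    Summable fun k : ℕ => ‖A ^ k‖ := by
  have hρ : spectralRadius ℂ (A.map Complex.ofReal) < 1 := by
    rcases (spectrum ℂ (A.map Complex.ofReal)).eq_empty_or_nonempty with h | h
    · simp [spectralRadius, h]
    · exact_mod_cast spectrum.spectralRadius_lt_of_forall_lt_of_nonempty h (r := 1)
        fun μ hμ => by exact_mod_cast hA μ hμ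
  refine (summable_norm_pow_of_spectralRadius_lt_one hρ).congr fun k => ?_
  have h : A.map Complex.ofReal ^ k = (A ^ k).map Complex.ofReal :=
    (map_pow (Complex.ofRealHom.mapMatrix) A k).symm
  simp [h, Matrix.linfty_opNorm_def]

/-- Iterating `x ↦ A x + w` inside an invariant set. -/
theorem Matrix.pow_mulVec_add_sum_mem_of_invariant {n : ℕ} {A : Matrix (Fin n) (Fin n) ℝ}
    {W S : Set (Fin n → ℝ)} (hS : ∀ x ∈ S, ∀ w ∈ W, A.mulVec x + w ∈ S)
    {s : Fin n → ℝ} (hs : s ∈ S) (l : ℕ) {w : ℕ → Fin n → ℝ} (hw : ∀ j, w j ∈ W) :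
    (A ^ l).mulVec s + ∑ j ∈ Finset.range l, (A ^ j).mulVec (w j) ∈ S := by
  induction l generalizing w with
  | zero => simpa using hs
  | succ l ih =>
    convert hS _ (ih fun j => hw (j + 1)) _ (hw 0) using 1
    simp [Finset.sum_range_succ', pow_succ', Matrix.mulVec_add, Matrix.mulVec_sum, add_assoc]

/-- for a Schur-stable `A` and compact nonempty disturbance set
`W`, the forward reachable sets `F_l = {∑_{j<l} A^j w_j : w_j ∈ W}` converge in
Hausdorff distance to the minimal robustly invariant set of `x⁺ = A x + w`. -/
theorem minimal_robust_invariant_set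
    {n : ℕ} (A : Matrix (Fin n) (Fin n) ℝ)
    (hA : ∀ μ ∈ spectrum ℂ (A.map (Complex.ofReal)), ‖μ‖ < 1)
    (W : Set (Fin n → ℝ)) (hWne : W.Nonempty) (hWc : IsCompact W)
    (F : ℕ → Set (Fin n → ℝ))
    (hF : ∀ l, F l = {x | ∃ w : Fin l → (Fin n → ℝ), (∀ j, w j ∈ W) ∧
      x = ∑ j : Fin l, (A ^ (j : ℕ)).mulVec (w j)}) :
    ∃ Sm : Set (Fin n → ℝ),
      Sm.Nonempty ∧ IsCompact Sm ∧
      Filter.Tendsto (fun l => Metric.hausdorffDist (F l) Sm)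
        Filter.atTop (nhds 0) ∧
      {y | ∃ x ∈ Sm, ∃ w ∈ W, y = A.mulVec x + w} ⊆ Sm ∧
      (∀ S : Set (Fin n → ℝ), S.Nonempty → IsClosed S →
        {y | ∃ x ∈ S, ∃ w ∈ W, y = A.mulVec x + w} ⊆ S → Sm ⊆ S) := by
  have hc : Summable fun k : ℕ => ‖A ^ k‖ := A.summable_linfty_opNorm_pow hA
  obtain ⟨M, hM⟩ := hWc.isBounded.exists_norm_le
  obtain ⟨w₀, hw₀⟩ := hWne
  have hM0 : 0 ≤ M := (norm_nonneg _).trans (hM w₀ hw₀)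
  have hu : Summable fun k : ℕ => ‖A ^ k‖ * M := hc.mul_right M
  have hbound : ∀ (k : ℕ) (w : Fin n → ℝ), w ∈ W → ‖(A ^ k).mulVec w‖ ≤ ‖A ^ k‖ * M :=
    fun k w hw => (Matrix.linfty_opNorm_mulVec _ _).trans
      (mul_le_mul_of_nonneg_left (hM w hw) (norm_nonneg _))
  have hsum : ∀ w : ℕ → W, Summable fun k : ℕ => (A ^ k).mulVec (w k : Fin n → ℝ) :=
    fun w => .of_norm_bounded hu fun k => hbound k _ (w k).2
  let Φ : (ℕ → W) → Fin n → ℝ := fun w => ∑' k : ℕ, (A ^ k).mulVec (w k : Fin n → ℝ)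
  have hΦ : Continuous Φ := continuous_tsum
    (fun k => Continuous.matrix_mulVec continuous_const (by fun_prop)) hu
    fun k w => hbound k _ (w k).2
  have : CompactSpace W := isCompact_iff_compactSpace.1 hWc
  have htail : ∀ (l : ℕ) (w : ℕ → W),
      dist (∑ k ∈ Finset.range l, (A ^ k).mulVec (w k : Fin n → ℝ)) (Φ w) ≤
        ∑' k, ‖A ^ (k + l)‖ * M := by
    intro l w
    rw [dist_comm, dist_eq_norm, show Φ w = _ from ((hsum w).sum_add_tsum_nat_add l).symm,
      add_sub_cancel_left]
    exact tsum_of_norm_bounded ((summable_nat_add_iff l).2 hu).hasSum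
      fun k => hbound _ _ (w (k + l)).2
  refine ⟨Set.range Φ, ⟨_, fun _ => ⟨w₀, hw₀⟩, rfl⟩, isCompact_range hΦ, ?_, ?_, ?_⟩
  · refine squeeze_zero (fun _ => Metric.hausdorffDist_nonneg) (fun l => ?_)
      (tendsto_sum_nat_add fun k => ‖A ^ k‖ * M)
    refine Metric.hausdorffDist_le_of_mem_dist
      (tsum_nonneg fun k => mul_nonneg (norm_nonneg _) hM0) ?_ ?_
    · intro x hx
      rw [hF] at hx
      obtain ⟨w, hw, rfl⟩ := hx
      let w' : ℕ → W := fun k => if h : k < l then ⟨w ⟨k, h⟩, hw _⟩ else ⟨w₀, hw₀⟩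
      refine ⟨Φ w', ⟨w', rfl⟩, ?_⟩
      convert htail l w' using 2
      rw [← Fin.sum_univ_eq_sum_range fun k => (A ^ k).mulVec (w' k : Fin n → ℝ)]
      simp [w']
    · rintro _ ⟨w, rfl⟩
      refine ⟨_, ?_, (dist_comm _ _).trans_le (htail l w)⟩
      rw [hF]
      exact ⟨fun j => w j, fun j => (w j).2, (Fin.sum_univ_eq_sum_range _ l).symm⟩
  · rintro _ ⟨_, ⟨w, rfl⟩, v, hv, rfl⟩
    let w' : ℕ → W := fun k => Nat.casesOn k ⟨v, hv⟩ w
    refine ⟨w', ?_⟩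
    have h : A.mulVec (Φ w) = ∑' k : ℕ, A.mulVec ((A ^ k).mulVec (w k : Fin n → ℝ)) :=
      ((hsum w).hasSum.map A.mulVecLin
        (Continuous.matrix_mulVec continuous_const continuous_id)).tsum_eq.symm
    rw [h, add_comm]
    simp [Φ, (hsum w').tsum_eq_zero_add, w', pow_succ']
  · rintro S ⟨s, hs⟩ hSc hS _ ⟨w, rfl⟩
    have h₁ : Tendsto (fun l : ℕ => (A ^ l).mulVec s) atTop (𝓝 0) :=
      squeeze_zero_norm (fun l => Matrix.linfty_opNorm_mulVec _ _)
        (by simpa using hc.tendsto_atTop_zero.mul_const ‖s‖)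
    have h₂ := h₁.add (hsum w).hasSum.tendsto_sum_nat
    rw [zero_add] at h₂
    exact hSc.mem_of_tendsto h₂ <| .of_forall fun l =>
      Matrix.pow_mulVec_add_sum_mem_of_invariant (fun x hx v hv => hS ⟨x, hx, v, hv, rfl⟩) hs l
        fun j => (w j).2
end
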